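/- Let K be a separable metric space and let f : K → ℝ be a bounded function with f ∈ DBSC(K). Then for every ε > 0, ε·i(f,ε) ≤ 4‖f‖_D. -/

import Mathlib

open Filter Topology Set

noncomputable section

/-- A real-valued function is bounded. -/
def BddFun {X : Type*} (f : X → ℝ) : Prop := ∃ C, ∀ x, |f x| ≤ C

/-- `f ∈ DBSC(X)`: `f` is a difference of bounded lower semicontinuous functions. -/
def MemDBSC {X : Type*} [TopologicalSpace X] (f : X → ℝ) : Prop :=
  ∃ u v : X → ℝ, BddFun u ∧ BddFun v ∧ LowerSemicontinuous u ∧ LowerSemicontinuous v ∧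
    f = u - v

/-- The D-norm of `f`. -/
def DNorm {X : Type*} [TopologicalSpace X] (f : X → ℝ) : ℝ :=
  sInf {c | ∃ φ : ℕ → X → ℝ, (∀ j, Continuous (φ j)) ∧ (∀ x, Summable fun j => |φ j x|) ∧
    (∀ x, ∑' j, φ j x = f x) ∧ (∀ x, ∑' j, |φ j x| ≤ c)}

/-- The sup-norm of `f`. -/
def supNorm {X : Type*} (f : X → ℝ) : ℝ := ⨆ x, |f x|

/-- A simple D-function: a D-function taking finitely many values. -/
def SimpleD {X : Type*} [TopologicalSpace X] (f : X → ℝ) : Prop :=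
  MemDBSC f ∧ (Set.range f).Finite

/-- `f ∈ SD(X)`: `f` is a strong D-function. -/
def MemSD {X : Type*} [TopologicalSpace X] (f : X → ℝ) : Prop :=
  ∃ φ : ℕ → X → ℝ, (∀ n, SimpleD (φ n)) ∧
    Tendsto (fun n => DNorm (f - φ n)) atTop (𝓝 0)

/-- `f ∈ B_{1/2}(X)`: `f` is a uniform limit of D-functions. -/
def MemBHalf {X : Type*} [TopologicalSpace X] (f : X → ℝ) : Prop :=
  ∃ g : ℕ → X → ℝ, (∀ n, MemDBSC (g n)) ∧ TendstoUniformly g f atTop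

/-- The upper semicontinuous envelope `Uf`. -/
def uEnv {X : Type*} [TopologicalSpace X] (f : X → ℝ) (x : X) : ℝ :=
  sInf {c | ∃ V : Set X, IsOpen V ∧ x ∈ V ∧ sSup (f '' V) = c}

/-- The lower oscillation of `f` at `x`. -/
def losc {X : Type*} [TopologicalSpace X] (f : X → ℝ) (x : X) : ℝ :=
  sInf {c | ∃ V : Set X, IsOpen V ∧ x ∈ V ∧ sSup ((fun y => |f y - f x|) '' V) = c}

/-- The oscillation of `f`: `osc f = U (losc f)`. -/
def osc {X : Type*} [TopologicalSpace X] (f : X → ℝ) : X → ℝ := uEnv (losc f)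

/-- The oscillation sets `os_n(f, ε)`. -/
def osSet {X : Type*} [TopologicalSpace X] (f : X → ℝ) (ε : ℝ) : ℕ → Set X
  | 0 => Set.univ
  | n + 1 => {x | ∃ h : x ∈ osSet f ε n, ε ≤ osc ((osSet f ε n).restrict f) ⟨x, h⟩}

/-- The `ε`-oscillation index `i(f, ε) = sup {n : os_n(f,ε) ≠ ∅}`. -/
def oscIndex {X : Type*} [TopologicalSpace X] (f : X → ℝ) (ε : ℝ) : ℕ∞ :=
  ⨆ (m : ℕ) (_ : (osSet f ε m).Nonempty), (m : ℕ∞)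

/-- `f` has finite Baire index. -/
def FiniteBaireIndex {X : Type*} [TopologicalSpace X] (f : X → ℝ) : Prop :=
  ∃ n : ℕ, ∀ ε > 0, osSet f ε n = ∅

/-- The Baire index `i(f) = sup_{ε > 0} i(f, ε)`. -/
def baireIndex {X : Type*} [TopologicalSpace X] (f : X → ℝ) : ℕ∞ :=
  ⨆ (ε : ℝ) (_ : 0 < ε), oscIndex f ε

/-- If `a < osc f x`, then near `x` there is a point in every neighborhood of which `f` varies by
more than `a`. -/
lemma exists_of_lt_osc {X : Type*} [TopologicalSpace X] {f : X → ℝ} {x : X} {a : ℝ}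
    (h : a < osc f x) {U : Set X} (hU : IsOpen U) (hx : x ∈ U) :
    ∃ y ∈ U, ∀ V : Set X, IsOpen V → y ∈ V → ∃ z ∈ V, a < |f z - f y| := by
  have losc_nonneg : ∀ y, 0 ≤ losc f y := by
    intro y
    apply Real.sInf_nonneg
    rintro _ ⟨V, -, -, rfl⟩
    apply Real.sSup_nonneg
    rintro _ ⟨z, -, rfl⟩
    exact abs_nonneg _
  have hle : osc f x ≤ sSup (losc f '' U) := by
    refine csInf_le ⟨0, ?_⟩ ⟨U, hU, hx, rfl⟩
    rintro _ ⟨V, -, -, rfl⟩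
    apply Real.sSup_nonneg
    rintro _ ⟨z, -, rfl⟩
    exact losc_nonneg z
  obtain ⟨_, ⟨y, hyU, rfl⟩, hy⟩ := exists_lt_of_lt_csSup (Set.Nonempty.image _ ⟨x, hx⟩) (h.trans_le hle)
  refine ⟨y, hyU, fun V hV hyV => ?_⟩
  have hle' : losc f y ≤ sSup ((fun z => |f z - f y|) '' V) := by
    refine csInf_le ⟨0, ?_⟩ ⟨V, hV, hyV, rfl⟩
    rintro _ ⟨W, -, -, rfl⟩
    apply Real.sSup_nonneg
    rintro _ ⟨z, -, rfl⟩
    exact abs_nonneg _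
  obtain ⟨_, ⟨z, hzV, rfl⟩, hz⟩ := exists_lt_of_lt_csSup (Set.Nonempty.image _ ⟨y, hyV⟩) (hy.trans_le hle')
  exact ⟨z, hzV, hz⟩

/-- If `s`, `s + f` and `s - f` are lower semicontinuous, a large oscillation of `f` forces a
large increase of `s`. -/
lemma exists_add_lt_of_lt_osc {X : Type*} [TopologicalSpace X] {f s : X → ℝ}
    (hs : LowerSemicontinuous s) (hadd : LowerSemicontinuous (s + f))
    (hsub : LowerSemicontinuous (s - f)) {x : X} {a : ℝ} (h : a < osc f x) {δ : ℝ} (hδ : 0 < δ) :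
    ∃ z, s x + a - δ < s z := by
  obtain ⟨U, hU, hUo, hxU⟩ := eventually_nhds_iff.1 (hs x (s x - δ / 2) (by linarith))
  obtain ⟨y, hyU, hy⟩ := exists_of_lt_osc h hUo hxU
  have hev := (hadd y ((s + f) y - δ / 2) (by linarith)).and
    (hsub y ((s - f) y - δ / 2) (by linarith))
  obtain ⟨V, hV, hVo, hyV⟩ := eventually_nhds_iff.1 hev
  obtain ⟨z, hzV, hz⟩ := hy V hVo hyV
  have h₁ := hU y hyU
  obtain ⟨h₂, h₃⟩ := hV z hzV
  simp only [Pi.add_apply, Pi.sub_apply] at h₂ h₃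
  refine ⟨z, ?_⟩
  rcases lt_abs.1 hz with h₄ | h₄ <;> linarith

lemma exists_add_mul_le_of_mem_osSet {X : Type*} [TopologicalSpace X] {f s : X → ℝ}
    (hs : LowerSemicontinuous s) (hadd : LowerSemicontinuous (s + f))
    (hsub : LowerSemicontinuous (s - f)) {ε δ : ℝ} (hδ : 0 < δ) (n : ℕ) :
    ∀ x ∈ osSet f ε n, ∃ z, s x + n * (ε - δ) ≤ s z := by
  induction n with
  | zero => exact fun x _ => ⟨x, by simp⟩
  | succ n ih =>
    rintro x ⟨hx, hosc⟩
    have hcont : Continuous (Subtype.val : osSet f ε n → X) := continuous_subtype_val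
    have hlt : ε - δ / 2 < osc (fun y : osSet f ε n => f y) ⟨x, hx⟩ :=
      (sub_lt_self ε (half_pos hδ)).trans_le hosc
    obtain ⟨⟨y, hy⟩, hxy⟩ := exists_add_lt_of_lt_osc (s := fun y : osSet f ε n => s y)
      (hs.comp hcont) (hadd.comp hcont) (hsub.comp hcont) hlt (half_pos hδ)
    obtain ⟨z, hz⟩ := ih y hy
    have hxy' : s x + (ε - δ / 2) - δ / 2 < s y := hxy
    refine ⟨z, ?_⟩
    push_cast
    linarith

lemma lowerSemicontinuous_tsum_of_nonneg {X ι : Type*} [TopologicalSpace X] {ψ : ι → X → ℝ}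
    (hψ : ∀ i, Continuous (ψ i)) (h0 : ∀ i x, 0 ≤ ψ i x) (hsum : ∀ x, Summable fun i => ψ i x) :
    LowerSemicontinuous fun x => ∑' i, ψ i x := by
  intro x a ha
  obtain ⟨F, hF⟩ := ((tendsto_order.1 (hsum x).hasSum).1 a ha).exists
  have hc : Continuous fun z => ∑ i ∈ F, ψ i z := continuous_finsetSum F fun i _ => hψ i
  filter_upwards [hc.continuousAt.eventually (lt_mem_nhds hF)] with z hz
  exact hz.trans_le ((hsum z).sum_le_tsum F fun i _ => h0 i z)

/-- If `f` is the sum of a series of continuous functions whose absolute values sum to at most `c`,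
then `osSet f ε n` can be nonempty only if `n * ε ≤ c`. -/
lemma natCast_mul_le_of_osSet_nonempty {X : Type*} [TopologicalSpace X] {f : X → ℝ}
    {φ : ℕ → X → ℝ} {c : ℝ} (hφ : ∀ j, Continuous (φ j)) (hsum : ∀ x, Summable fun j => |φ j x|)
    (hf : ∀ x, ∑' j, φ j x = f x) (hc : ∀ x, ∑' j, |φ j x| ≤ c) {ε : ℝ} {n : ℕ}
    (hn : (osSet f ε n).Nonempty) : n * ε ≤ c := by
  have hs := lowerSemicontinuous_tsum_of_nonneg (fun j => (hφ j).abs)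
    (fun j x => abs_nonneg (φ j x)) hsum
  have hadd : LowerSemicontinuous ((fun x => ∑' j, |φ j x|) + f) := by
    convert lowerSemicontinuous_tsum_of_nonneg (ψ := fun j x => |φ j x| + φ j x)
      (fun j => (hφ j).abs.add (hφ j)) (fun j x => by linarith [neg_abs_le (φ j x)])
      (fun x => (hsum x).add (hsum x).of_abs) using 2 with x
    rw [(hsum x).tsum_add (hsum x).of_abs, hf x]
    rfl
  have hsub : LowerSemicontinuous ((fun x => ∑' j, |φ j x|) - f) := by
    convert lowerSemicontinuous_tsum_of_nonneg (ψ := fun j x => |φ j x| - φ j x)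
      (fun j => (hφ j).abs.sub (hφ j)) (fun j x => by linarith [le_abs_self (φ j x)])
      (fun x => (hsum x).sub (hsum x).of_abs) using 2 with x
    rw [(hsum x).tsum_sub (hsum x).of_abs, hf x]
    rfl
  obtain ⟨x, hx⟩ := hn
  refine le_of_forall_pos_le_add fun η hη => ?_
  obtain ⟨z, hz⟩ := exists_add_mul_le_of_mem_osSet hs hadd hsub
    (δ := η / (n + 1)) (by positivity) n x hx
  have h0 : 0 ≤ ∑' j, |φ j x| := tsum_nonneg fun j => abs_nonneg _
  have hle : n * (η / (n + 1)) ≤ η := by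
    rw [mul_div_assoc', div_le_iff₀ (by positivity)]
    nlinarith
  have := hc z
  linarith

/-- A nonnegative lower semicontinuous function on a metric space is the limit of an increasing
sequence of continuous functions starting at `0`. -/
lemma LowerSemicontinuous.exists_monotone_continuous_tendsto {X : Type*} [PseudoMetricSpace X]
    {u : X → ℝ} (hu : LowerSemicontinuous u) (h0 : ∀ x, 0 ≤ u x) :
    ∃ U : ℕ → X → ℝ, (∀ n, Continuous (U n)) ∧ U 0 = 0 ∧ (∀ x, Monotone fun n => U n x) ∧
      ∀ x, Tendsto (fun n => U n x) atTop (𝓝 (u x)) := by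
  let R : ℕ → X → ℝ := fun n x => ⨅ y, (u y + n * dist x y)
  have hbdd : ∀ (n : ℕ) x, BddBelow (range fun y => u y + n * dist x y) := by
    intro n x
    refine ⟨0, ?_⟩
    rintro _ ⟨y, rfl⟩
    exact add_nonneg (h0 y) (mul_nonneg n.cast_nonneg dist_nonneg)
  have hle : ∀ n x y, R n x ≤ u y + n * dist x y := fun n x y => ciInf_le (hbdd n x) y
  have hR0 : ∀ n x, 0 ≤ R n x := by
    intro n x
    refine Real.iInf_nonneg fun y => ?_
    exact add_nonneg (h0 y) (by positivity)
  have hcont : ∀ n, Continuous (R n) := by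
    intro n
    refine (LipschitzWith.of_le_add_mul (n : NNReal) fun x y => ?_).continuous
    have : Nonempty X := ⟨x⟩
    rw [← sub_le_iff_le_add]
    refine le_ciInf fun z => ?_
    have h₁ := hle n x z
    have h₂ := mul_le_mul_of_nonneg_left (dist_triangle x y z) n.cast_nonneg (α := ℝ)
    simp only [NNReal.coe_natCast]
    linarith
  have hmono : ∀ x, Monotone fun n => R n x := by
    intro x m n hmn
    have : Nonempty X := ⟨x⟩
    refine le_ciInf fun z => (hle m x z).trans ?_
    gcongr
  have htend : ∀ x, Tendsto (fun n => R n x) atTop (𝓝 (u x)) := by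
    intro x
    have : Nonempty X := ⟨x⟩
    refine tendsto_order.2 ⟨fun a ha => ?_, fun a ha => Eventually.of_forall fun n => ?_⟩
    · obtain ⟨b, hab, hb⟩ := exists_between ha
      obtain ⟨δ, hδ, hball⟩ := Metric.eventually_nhds_iff.1 (hu x b hb)
      filter_upwards [(tendsto_natCast_atTop_atTop (R := ℝ)).eventually_ge_atTop (b / δ)] with n hn
      refine hab.trans_le (le_ciInf fun y => ?_)
      rcases lt_or_ge (dist x y) δ with hy | hy
      · have h₁ := hball (dist_comm x y ▸ hy)
        have h₂ : 0 ≤ (n : ℝ) * dist x y := by positivity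
        linarith
      · have h₁ := (div_le_iff₀ hδ).1 hn
        have h₂ := mul_le_mul_of_nonneg_left hy n.cast_nonneg (α := ℝ)
        linarith [h0 y]
    · exact lt_of_le_of_lt (by simpa using hle n x x) ha
  refine ⟨fun n => n.casesOn 0 R, ?_, rfl, fun x => monotone_nat_of_le_succ ?_, fun x => ?_⟩
  · rintro (_ | n)
    exacts [continuous_const, hcont n]
  · rintro (_ | n)
    exacts [hR0 0 x, hmono x n.le_succ]
  · exact (tendsto_add_atTop_iff_nat 1).1 (htend x)

/-- A nonnegative lower semicontinuous function on a metric space is the sum of a series of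
nonnegative continuous functions. -/
lemma LowerSemicontinuous.exists_continuous_hasSum {X : Type*} [PseudoMetricSpace X]
    {u : X → ℝ} (hu : LowerSemicontinuous u) (h0 : ∀ x, 0 ≤ u x) :
    ∃ a : ℕ → X → ℝ, (∀ n, Continuous (a n)) ∧ (∀ n x, 0 ≤ a n x) ∧
      ∀ x, HasSum (fun n => a n x) (u x) := by
  obtain ⟨U, hUc, hU0, hUm, hUt⟩ := hu.exists_monotone_continuous_tendsto h0
  have hnn : ∀ n x, 0 ≤ U (n + 1) x - U n x := fun n x => sub_nonneg.2 (hUm x n.le_succ)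
  refine ⟨fun n x => U (n + 1) x - U n x, fun n => (hUc (n + 1)).sub (hUc n), hnn, fun x => ?_⟩
  rw [hasSum_iff_tendsto_nat_of_nonneg fun n => hnn n x]
  simpa [Finset.sum_range_sub (fun n => U n x), hU0] using hUt x

/-- The set whose infimum defines the D-norm of a D-function is nonempty. -/
lemma MemDBSC.exists_series {X : Type*} [PseudoMetricSpace X] {f : X → ℝ} (hf : MemDBSC f) :
    ∃ (c : ℝ) (φ : ℕ → X → ℝ), (∀ j, Continuous (φ j)) ∧ (∀ x, Summable fun j => |φ j x|) ∧
      (∀ x, ∑' j, φ j x = f x) ∧ ∀ x, ∑' j, |φ j x| ≤ c := by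
  obtain ⟨u, v, ⟨A, hA⟩, ⟨B, hB⟩, hu, hv, rfl⟩ := hf
  obtain ⟨C, hCu, hCv⟩ : ∃ C, (∀ x, |u x| ≤ C) ∧ ∀ x, |v x| ≤ C :=
    ⟨max A B, fun x => (hA x).trans (le_max_left _ _), fun x => (hB x).trans (le_max_right _ _)⟩
  have hcc : LowerSemicontinuous fun _ : X => C := lowerSemicontinuous_const
  obtain ⟨a, hac, ha0, ha⟩ := (hu.add hcc).exists_continuous_hasSum
    fun x => by linarith [neg_le_of_abs_le (hCu x)]
  obtain ⟨b, hbc, hb0, hb⟩ := (hv.add hcc).exists_continuous_hasSum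
    fun x => by linarith [neg_le_of_abs_le (hCv x)]
  have hle : ∀ j x, |a j x - b j x| ≤ a j x + b j x := by
    intro j x
    have h₁ := ha0 j x
    have h₂ := hb0 j x
    rw [abs_le]
    constructor <;> linarith
  have hadd : ∀ x, HasSum (fun j => a j x + b j x) (u x + C + (v x + C)) := fun x =>
    (ha x).add (hb x)
  have hsub : ∀ x, HasSum (fun j => a j x - b j x) (u x + C - (v x + C)) := fun x =>
    (ha x).sub (hb x)
  have hsum : ∀ x, Summable fun j => |a j x - b j x| := fun x =>
    Summable.of_nonneg_of_le (fun j => abs_nonneg _) (fun j => hle j x) (hadd x).summable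
  refine ⟨4 * C, fun j x => a j x - b j x, fun j => (hac j).sub (hbc j), hsum,
    fun x => ?_, fun x => ?_⟩
  · rw [(hsub x).tsum_eq, add_sub_add_right_eq_sub, Pi.sub_apply]
  · have h := (hsum x).tsum_le_tsum (fun j => hle j x) (hadd x).summable
    rw [(hadd x).tsum_eq] at h
    linarith [le_of_abs_le (hCu x), le_of_abs_le (hCv x)]

open scoped ENNReal

/-- **Lemma (2.9 in §2).** If `f ∈ DBSC(K)`, then `ε · i(f, ε) ≤ 4 ‖f‖_D` for
every `ε > 0`. -/
theorem oscIndex_le_of_memDBSC {K : Type*} [MetricSpace K]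
    [TopologicalSpace.SeparableSpace K] (f : K → ℝ) (hb : BddFun f)
    (hf : MemDBSC f) (ε : ℝ) (hε : 0 < ε) :
    ENNReal.ofReal ε * (oscIndex f ε : ℝ≥0∞) ≤ ENNReal.ofReal (4 * DNorm f) := by
  obtain hK | hK := isEmpty_or_nonempty K
  · have h : oscIndex f ε = 0 := by
      simp [oscIndex, Set.Nonempty]
    simp [h]
  have hD : 0 ≤ DNorm f := by
    refine Real.sInf_nonneg ?_
    rintro c ⟨φ, -, -, -, hc⟩
    exact (tsum_nonneg fun j => abs_nonneg _).trans (hc (Classical.arbitrary K))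
  have hn : ∀ n : ℕ, (osSet f ε n).Nonempty → n * ε ≤ DNorm f := by
    refine fun n hn => le_csInf hf.exists_series ?_
    rintro c ⟨φ, hφ, hsum, hφf, hc⟩
    exact natCast_mul_le_of_osSet_nonempty hφ hsum hφf hc hn
  have hi : oscIndex f ε ≤ (⌊DNorm f / ε⌋₊ : ℕ) := by
    refine iSup₂_le fun n hne => ?_
    exact_mod_cast Nat.le_floor ((le_div_iff₀ hε).2 (hn n hne))
  have hfl : ε * ⌊DNorm f / ε⌋₊ ≤ DNorm f := by
    rw [mul_comm]
    exact (le_div_iff₀ hε).1 (Nat.floor_le (by positivity))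
  calc ENNReal.ofReal ε * (oscIndex f ε : ℝ≥0∞)
      ≤ ENNReal.ofReal ε * ((⌊DNorm f / ε⌋₊ : ℕ) : ℝ≥0∞) := by
        gcongr
        exact_mod_cast hi
    _ = ENNReal.ofReal (ε * ⌊DNorm f / ε⌋₊) := by
        rw [ENNReal.ofReal_mul hε.le, ENNReal.ofReal_natCast]
    _ ≤ ENNReal.ofReal (4 * DNorm f) := ENNReal.ofReal_le_ofReal (by linarith)
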